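/- Let m ∈ (1/2)ℤ_{>0}, let s, s₁ ∈ ℤ and s′, s′₁ ∈ 1/2 + ℤ. For every τ with Im τ > 0 and all z₁, z₂ ∈ ℂ with z₁ ∉ ℤ + ℤτ, the following four S-transformation formulas hold: (1) Φ̃^{+[m;s]}(−1/τ, z₁/τ, z₂/τ) = τ e^{2πi m z₁ z₂/τ} Φ̃^{+[m;s₁]}(τ, z₁, z₂); (2) Φ̃^{−[m;s]}(−1/τ, z₁/τ, z₂/τ) = τ e^{2πi m z₁ z₂/τ} Φ̃^{+[m;s′]}(τ, z₁, z₂); (3) Φ̃^{+[m;s′]}(−1/τ, z₁/τ, z₂/τ) = τ e^{2πi m z₁ z₂/τ} Φ̃^{−[m;s]}(τ, z₁, z₂); (4) Φ̃^{−[m;s′]}(−1/τ, z₁/τ, z₂/τ) = τ e^{2πi m z₁ z₂/τ} Φ̃^{−[m;s′₁]}(τ, z₁, z₂). -/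

import Mathlib

noncomputable section

open Complex

/-- `mexp w = e^{2πi w}`. -/
def mexp (w : ℂ) : ℂ := Complex.exp (2 * (Real.pi : ℂ) * Complex.I * w)

/-- The signed mock theta function `Φ^{sgn[m;s]}(τ,z₁,z₂)`. -/
def PhiS (sgn : ℂ) (m s : ℝ) (τ z₁ z₂ : ℂ) : ℂ :=
  ∑' n : ℤ, sgn ^ n *
    mexp ((m : ℂ) * n * (z₁ + z₂) + (s : ℂ) * z₁ + τ * ((m : ℂ) * n ^ 2 + (s : ℂ) * n)) /
    (1 - mexp (z₁ + n * τ))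

/-- The signed theta function `Θ^{sgn}_{j,m}(τ,z)`. -/
def ThetaS (sgn : ℂ) (j m : ℝ) (τ z : ℂ) : ℂ :=
  ∑' n : ℤ, sgn ^ n *
    mexp ((m : ℂ) * z * ((n : ℂ) + ((j / (2 * m) : ℝ) : ℂ)) +
      τ * (m : ℂ) * ((n : ℂ) + ((j / (2 * m) : ℝ) : ℂ)) ^ 2)

/-- `E(x) = 2∫₀ˣ e^{-πu²} du`. -/
def Efun (x : ℝ) : ℝ := 2 * ∫ u in (0:ℝ)..x, Real.exp (-Real.pi * u ^ 2)

/-- `ψ_{m,n}(τ,z) = (n - 2m Im z / Im τ) √(Im τ / m)`. -/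
def psiMN (m n : ℝ) (τ z : ℂ) : ℝ := (n - 2 * m * z.im / τ.im) * Real.sqrt (τ.im / m)

/-- The real-analytic correction `R^{sgn}_{j,m}(τ,z)`; the summation variable `n ∈ j + 2mℤ`
is written as `n = j + 2mk`, `k ∈ ℤ`, so that `(±1)^{(n-j)/(2m)} = sgn^k`. -/
def RS (sgn : ℂ) (j m : ℝ) (τ z : ℂ) : ℂ :=
  ∑' k : ℤ, sgn ^ k *
    (((Real.sign (j + 2 * m * k - 1 / 2 - j + 2 * m) -
        Efun (psiMN m (j + 2 * m * k) τ z) : ℝ)) : ℂ) *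
    Complex.exp (-(Real.pi : ℂ) * Complex.I * (((j + 2 * m * k : ℝ)) : ℂ) ^ 2 * τ / (2 * (m : ℂ))
      + 2 * (Real.pi : ℂ) * Complex.I * (((j + 2 * m * k : ℝ)) : ℂ) * z)

/-- The modifier `Φ^{sgn[m;s]}_add`; the summation variable `j ∈ s + ℤ`, `s ≤ j < s + 2m`
is written as `j = s + i`, `0 ≤ i < ⌈2m⌉`. -/
def PhiAddS (sgn : ℂ) (m s : ℝ) (τ z₁ z₂ : ℂ) : ℂ :=
  ∑ i ∈ Finset.range ⌈2 * m⌉₊,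
    RS sgn (s + i) m τ ((z₁ - z₂) / 2) * ThetaS sgn (s + i) m τ (z₁ + z₂)

/-- The modified (signed) mock theta function `Φ̃^{sgn[m;s]}`. -/
def PhiTilde (sgn : ℂ) (m s : ℝ) (τ z₁ z₂ : ℂ) : ℂ :=
  PhiS sgn m s τ z₁ z₂ - (1 / 2) * PhiAddS sgn m s τ z₁ z₂

end

section Efun

open MeasureTheory Filter

lemma hasDerivAt_Efun (x : ℝ) : HasDerivAt Efun (2 * Real.exp (-Real.pi * x ^ 2)) x := by
  have hc : Continuous fun u : ℝ => Real.exp (-Real.pi * u ^ 2) := by fun_prop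
  exact (intervalIntegral.integral_hasDerivAt_right (hc.intervalIntegrable _ _)
    (hc.stronglyMeasurableAtFilter _ _) hc.continuousAt).const_mul 2

lemma Efun_neg (x : ℝ) : Efun (-x) = -Efun x := by
  have h := intervalIntegral.integral_comp_neg (a := 0) (b := x)
    (fun u : ℝ => Real.exp (-Real.pi * u ^ 2))
  simp only [neg_zero, neg_sq] at h
  unfold Efun
  rw [h, intervalIntegral.integral_symm]
  ring

lemma abs_one_sub_Efun_le {x : ℝ} (hx : 0 ≤ x) : |1 - Efun x| ≤ Real.exp (-Real.pi * x ^ 2) := by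
  have hint : Integrable fun u : ℝ => Real.exp (-Real.pi * u ^ 2) :=
    integrable_exp_neg_mul_sq Real.pi_pos
  have htot : ∫ u in Set.Ioi (0 : ℝ), Real.exp (-Real.pi * u ^ 2) = 1 / 2 := by
    rw [integral_gaussian_Ioi, div_self Real.pi_ne_zero, Real.sqrt_one]
  have hsplit := intervalIntegral.integral_interval_add_Ioi (a := 0) (b := x)
    hint.integrableOn hint.integrableOn
  have hshift : ∫ u in Set.Ioi x, Real.exp (-Real.pi * u ^ 2)
      = ∫ v in Set.Ioi (0 : ℝ), Real.exp (-Real.pi * (v + x) ^ 2) := by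
    have := (measurePreserving_add_right volume x).setIntegral_preimage_emb
      (measurableEmbedding_addRight x) (fun u : ℝ => Real.exp (-Real.pi * u ^ 2)) (Set.Ioi x)
    rw [← this]
    simp
  have heq : 1 - Efun x = 2 * ∫ v in Set.Ioi (0 : ℝ), Real.exp (-Real.pi * (v + x) ^ 2) := by
    rw [← hshift]
    unfold Efun
    linarith
  have hle : ∫ v in Set.Ioi (0 : ℝ), Real.exp (-Real.pi * (v + x) ^ 2)
      ≤ ∫ v in Set.Ioi (0 : ℝ), Real.exp (-Real.pi * x ^ 2) * Real.exp (-Real.pi * v ^ 2) := by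
    refine setIntegral_mono_on ?_ (hint.const_mul _).integrableOn measurableSet_Ioi ?_
    · exact (hint.comp_add_right x).integrableOn
    · intro v hv
      rw [← Real.exp_add]
      apply Real.exp_le_exp.mpr
      have : 0 ≤ Real.pi * (v * x) := mul_nonneg Real.pi_pos.le (mul_nonneg (le_of_lt hv) hx)
      nlinarith
  rw [integral_const_mul, htot] at hle
  have hnn : 0 ≤ ∫ v in Set.Ioi (0 : ℝ), Real.exp (-Real.pi * (v + x) ^ 2) :=
    integral_nonneg fun v => (Real.exp_pos _).le
  rw [heq, abs_of_nonneg (by positivity)]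
  linarith

/-- The sign of an integer, with the convention that `0` is positive. -/
def intSign (p : ℤ) : ℝ := if 0 ≤ p then 1 else -1

lemma eventually_abs_intSign_sub_Efun_le {A : ℝ} (hA : 0 < A) (B : ℝ) :
    ∀ᶠ k : ℤ in cofinite,
      |intSign k - Efun (A * k + B)| ≤ Real.exp (-Real.pi * (A * k + B) ^ 2) := by
  rw [Int.cofinite_eq, eventually_sup]
  constructor
  · filter_upwards [eventually_lt_atBot (0 : ℤ), eventually_le_atBot ⌊-B / A⌋] with k hk hk'
    have h1 : A * k + B ≤ 0 := by
      have := Int.le_floor.mp hk'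
      rw [le_div_iff₀ hA] at this
      linarith
    have h := abs_one_sub_Efun_le (neg_nonneg.mpr h1)
    rw [Efun_neg, neg_sq] at h
    rw [intSign, if_neg (not_le.mpr hk), ← abs_neg]
    convert h using 2
    ring
  · filter_upwards [eventually_ge_atTop (0 : ℤ), eventually_ge_atTop ⌈-B / A⌉] with k hk hk'
    have h1 : 0 ≤ A * k + B := by
      have := Int.ceil_le.mp hk'
      rw [div_le_iff₀ hA] at this
      linarith
    rw [intSign, if_pos hk]
    exact abs_one_sub_Efun_le h1

lemma summable_exp_neg_quadratic {a : ℝ} (ha : 0 < a) (b d : ℝ) :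
    Summable fun n : ℤ => Real.exp (-a * n ^ 2 + b * n + d) := by
  have h := ((summable_jacobiTheta₂_term_iff (Complex.I * ((-b / (2 * Real.pi) : ℝ) : ℂ))
    (Complex.I * ((a / Real.pi : ℝ) : ℂ))).mpr (by
      simpa using div_pos ha Real.pi_pos)).norm.mul_right (Real.exp d)
  refine h.congr fun n => ?_
  rw [norm_jacobiTheta₂_term, ← Real.exp_add]
  congr 1
  have hpi := Real.pi_ne_zero
  simp only [Complex.mul_im, Complex.I_re, Complex.I_im, Complex.ofReal_im, Complex.ofReal_re]
  field_simp
  ring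

end Efun

section Appell

open Filter Complex

lemma tsum_gaussian_poisson {α : ℝ} (hα : 0 < α) (s c : ℝ) (w : ℂ) :
    (Real.sqrt α : ℂ) * ∑' p : ℤ, (Real.exp (-Real.pi * ((s + p - c) * Real.sqrt α) ^ 2) : ℂ) *
        cexp (2 * Real.pi * I * (s + p) * w) =
      ∑' b : ℤ, cexp (-2 * Real.pi * I * s * b) *
        cexp (-Real.pi * (w + b) ^ 2 / α + 2 * Real.pi * I * c * (w + b)) := by
  have hα' : (α : ℂ) ≠ 0 := by exact_mod_cast hα.ne'
  have hs : (Real.sqrt α : ℂ) ≠ 0 := by exact_mod_cast (Real.sqrt_pos.mpr hα).ne'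
  have hsq : (Real.sqrt α : ℂ) ^ 2 = α := by exact_mod_cast Real.sq_sqrt hα.le
  have hroot : (α : ℂ) ^ (1 / 2 : ℂ) = Real.sqrt α := by
    rw [Real.sqrt_eq_rpow, Complex.ofReal_cpow hα.le]
    norm_num
  have h := Complex.tsum_exp_neg_quadratic (a := (α : ℂ)) (by simpa using hα)
    (-α * (s - c) + I * w)
  rw [hroot] at h
  have hl : ∀ p : ℤ, (Real.exp (-Real.pi * ((s + p - c) * Real.sqrt α) ^ 2) : ℂ) *
        cexp (2 * Real.pi * I * (s + p) * w) =
      cexp (-Real.pi * α * (s - c) ^ 2 + 2 * Real.pi * I * s * w) *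
        cexp (-Real.pi * α * p ^ 2 + 2 * Real.pi * (-α * (s - c) + I * w) * p) := by
    intro p
    push_cast
    rw [← Complex.exp_add, ← Complex.exp_add, mul_pow, hsq]
    congr 1
    ring
  have hr : ∀ b : ℤ, cexp (-2 * Real.pi * I * s * b) *
        cexp (-Real.pi * (w + b) ^ 2 / α + 2 * Real.pi * I * c * (w + b)) =
      cexp (-Real.pi * α * (s - c) ^ 2 + 2 * Real.pi * I * s * w) *
        cexp (-Real.pi / α * ((Equiv.neg ℤ b : ℤ) + I * (-α * (s - c) + I * w)) ^ 2) := by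
    intro b
    rw [← Complex.exp_add, ← Complex.exp_add]
    congr 1
    simp only [Equiv.neg_apply, Int.cast_neg]
    have hI : I * (-α * (s - c) + I * w) = -(w + I * α * (s - c)) := by
      linear_combination w * I_sq
    rw [hI]
    field_simp
    linear_combination (α ^ 2 * (s - c) ^ 2 : ℂ) * I_sq
  rw [tsum_congr hl, tsum_congr hr, tsum_mul_left, tsum_mul_left, h,
    (Equiv.neg ℤ).tsum_eq fun n : ℤ =>
      cexp (-Real.pi / α * (n + I * (-α * (s - c) + I * w)) ^ 2)]
  field_simp

/-- The general term of the non-holomorphic part attached to one summand of the Appell sum. -/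
noncomputable def errTerm (α s c : ℝ) (w : ℂ) (p : ℤ) : ℂ :=
  ((intSign p - Efun ((s + p - c) * Real.sqrt α) : ℝ) : ℂ) * cexp (2 * Real.pi * I * (s + p) * w)

lemma norm_cexp_two_pi (r : ℝ) (w : ℂ) :
    ‖cexp (2 * Real.pi * I * r * w)‖ = Real.exp (-2 * Real.pi * w.im * r) := by
  rw [Complex.norm_exp]
  congr 1
  simp
  ring

lemma norm_cexp_two_pi' (s : ℝ) (p : ℤ) (w : ℂ) :
    ‖cexp (2 * Real.pi * I * (s + p) * w)‖ = Real.exp (-2 * Real.pi * w.im * (s + p)) := by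
  have := norm_cexp_two_pi (s + p) w
  push_cast at this
  exact this

lemma summable_errTerm {α : ℝ} (hα : 0 < α) (s c : ℝ) (w : ℂ) :
    Summable (errTerm α s c w) := by
  have hs := Real.sqrt_pos.mpr hα
  refine Summable.of_norm_bounded_eventually (summable_exp_neg_quadratic
    (mul_pos Real.pi_pos hα) (-2 * Real.pi * α * (s - c) - 2 * Real.pi * w.im)
    (-Real.pi * α * (s - c) ^ 2 - 2 * Real.pi * w.im * s)) ?_
  filter_upwards [eventually_abs_intSign_sub_Efun_le hs ((s - c) * Real.sqrt α)] with p hp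
  rw [errTerm, norm_mul, Complex.norm_real, norm_cexp_two_pi', Real.norm_eq_abs]
  have h1 : Real.sqrt α * p + (s - c) * Real.sqrt α = (s + p - c) * Real.sqrt α := by ring
  rw [h1] at hp
  refine (mul_le_mul_of_nonneg_right hp (Real.exp_pos _).le).trans_eq ?_
  rw [← Real.exp_add, mul_pow, Real.sq_sqrt hα.le]
  congr 1
  ring

lemma hasDerivAt_tsum_errTerm {α : ℝ} (hα : 0 < α) (s : ℝ) (w : ℂ) (c : ℝ) :
    HasDerivAt (fun c => ∑' p, errTerm α s c w p)
      (2 * ((Real.sqrt α : ℂ) * ∑' p : ℤ,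
        (Real.exp (-Real.pi * ((s + p - c) * Real.sqrt α) ^ 2) : ℂ) *
          cexp (2 * Real.pi * I * (s + p) * w))) c := by
  rw [← tsum_mul_left, ← tsum_mul_left]
  set B : ℝ := |s - c| + 1 with hB
  refine hasDerivAt_tsum_of_isPreconnected (g := fun (p : ℤ) (c : ℝ) => errTerm α s c w p)
    (g' := fun (p : ℤ) (c : ℝ) => 2 * ((Real.sqrt α : ℂ) *
      ((Real.exp (-Real.pi * ((s + p - c) * Real.sqrt α) ^ 2) : ℂ) *
        cexp (2 * Real.pi * I * (s + p) * w))))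
    (u := fun p : ℤ => 2 * Real.sqrt α *
      Real.exp (-(Real.pi * α / 2) * p ^ 2 + (-2 * Real.pi * w.im) * p +
        (Real.pi * α * B ^ 2 - 2 * Real.pi * w.im * s)))
    (t := Set.Ioo (c - 1) (c + 1)) (y₀ := c) ?_ isOpen_Ioo isPreconnected_Ioo ?_ ?_ ?_
    (summable_errTerm hα s c w) ?_
  · exact (summable_exp_neg_quadratic (by positivity) _ _).mul_left _
  · intro p y _
    have h1 : HasDerivAt (fun c : ℝ => (s + p - c) * Real.sqrt α) (-Real.sqrt α) y := by
      simpa using (((hasDerivAt_id y).const_sub (s + p)).mul_const (Real.sqrt α))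
    have h2 := (((hasDerivAt_Efun _).comp y h1).const_sub (intSign p)).ofReal_comp.mul_const
      (cexp (2 * Real.pi * I * (s + p) * w))
    convert! h2 using 1
    push_cast
    ring
  · intro p y hy
    rw [norm_mul, norm_mul, norm_mul, norm_cexp_two_pi', Complex.norm_real, Complex.norm_real,
      Real.norm_of_nonneg (Real.sqrt_nonneg _), Real.norm_of_nonneg (Real.exp_pos _).le,
      ← Real.exp_add, ← mul_assoc, Complex.norm_ofNat]
    refine mul_le_mul_of_nonneg_left (Real.exp_le_exp.mpr ?_) (by positivity)
    rw [mul_pow, Real.sq_sqrt hα.le]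
    have h3 : (s - y) ^ 2 ≤ B ^ 2 := by
      apply sq_le_sq'
      · have := neg_abs_le (s - c); have := hy.2; linarith
      · have := le_abs_self (s - c); have := hy.1; linarith
    have h4 : (p : ℝ) ^ 2 / 2 - B ^ 2 ≤ (s + p - y) ^ 2 := by
      nlinarith [sq_nonneg ((p : ℝ) + 2 * (s - y))]
    have h5 := mul_le_mul_of_nonneg_left h4 (mul_pos Real.pi_pos hα).le
    nlinarith
  · constructor <;> linarith
  · constructor <;> linarith

/-- The general term of the lattice sum in one direction. -/
noncomputable def latTerm (α s c : ℝ) (w : ℂ) (b : ℤ) : ℂ :=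
  cexp (-2 * Real.pi * I * s * b) *
    cexp (-Real.pi * (w + b) ^ 2 / α + 2 * Real.pi * I * c * (w + b)) / (w + b)

lemma norm_latTerm_numerator (α s c : ℝ) (w : ℂ) (b : ℤ) :
    ‖cexp (-2 * Real.pi * I * s * b) *
      cexp (-Real.pi * (w + b) ^ 2 / α + 2 * Real.pi * I * c * (w + b))‖ =
    Real.exp (-(Real.pi / α) * b ^ 2 + (-(2 * Real.pi / α) * w.re) * b +
      (-(Real.pi / α) * (w.re ^ 2 - w.im ^ 2) - 2 * Real.pi * c * w.im)) := by
  rw [← Complex.exp_add, Complex.norm_exp]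
  congr 1
  simp [pow_two, Complex.div_ofReal_re]
  ring

lemma tendsto_inv_add_intCast (w : ℂ) :
    Tendsto (fun b : ℤ => (w + b)⁻¹) cofinite (nhds 0) := by
  refine tendsto_inv₀_cobounded.comp ?_
  refine tendsto_norm_atTop_iff_cobounded.mp ?_
  have h : Tendsto (fun b : ℤ => ‖(b : ℝ)‖ - ‖w‖) cofinite atTop :=
    tendsto_atTop_add_const_right _ _ ((tendsto_norm_cocompact_atTop (E := ℝ)).comp
      Int.tendsto_coe_cofinite)
  refine tendsto_atTop_mono (fun b => ?_) h
  have := norm_sub_le (w + b) w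
  rw [add_sub_cancel_left] at this
  have h2 : ‖(b : ℂ)‖ = ‖(b : ℝ)‖ := by simp
  linarith

lemma summable_latTerm {α : ℝ} (hα : 0 < α) (s c : ℝ) (w : ℂ) : Summable (latTerm α s c w) := by
  unfold latTerm
  simp_rw [div_eq_mul_inv _ (w + _)]
  refine Summable.mul_tendsto_const ?_ (tendsto_inv_add_intCast w)
  simp_rw [norm_latTerm_numerator]
  exact summable_exp_neg_quadratic (by positivity) _ _

lemma hasDerivAt_tsum_latTerm {α : ℝ} (hα : 0 < α) (s : ℝ) {w : ℂ} (hw : ∀ b : ℤ, w + b ≠ 0)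
    (c : ℝ) :
    HasDerivAt (fun c => ∑' b, latTerm α s c w b)
      (2 * Real.pi * I * ∑' b : ℤ, cexp (-2 * Real.pi * I * s * b) *
        cexp (-Real.pi * (w + b) ^ 2 / α + 2 * Real.pi * I * c * (w + b))) c := by
  rw [← tsum_mul_left]
  refine hasDerivAt_tsum_of_isPreconnected (g := fun (b : ℤ) (c : ℝ) => latTerm α s c w b)
    (g' := fun (b : ℤ) (c : ℝ) => 2 * Real.pi * I * (cexp (-2 * Real.pi * I * s * b) *
        cexp (-Real.pi * (w + b) ^ 2 / α + 2 * Real.pi * I * c * (w + b))))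
    (u := fun b : ℤ => 2 * Real.pi *
      Real.exp (-(Real.pi / α) * b ^ 2 + (-(2 * Real.pi / α) * w.re) * b +
      (-(Real.pi / α) * (w.re ^ 2 - w.im ^ 2) + 2 * Real.pi * ((|c| + 1) * |w.im|))))
    (t := Set.Ioo (c - 1) (c + 1)) (y₀ := c) ?_ isOpen_Ioo isPreconnected_Ioo ?_ ?_ ?_
    (summable_latTerm hα s c w) ?_
  · exact (summable_exp_neg_quadratic (by positivity) _ _).mul_left _
  · intro b y _
    have h1 : HasDerivAt (fun c : ℝ => -Real.pi * (w + b) ^ 2 / α + 2 * Real.pi * I * c * (w + b))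
        (2 * Real.pi * I * (w + b)) y := by
      simpa using (((Complex.ofRealCLM.hasDerivAt (x := y)).const_mul
        (2 * Real.pi * I)).mul_const (w + b)).const_add (-Real.pi * (w + b) ^ 2 / α)
    have h2 := ((h1.cexp).const_mul (cexp (-2 * Real.pi * I * s * b))).div_const (w + b)
    convert! h2 using 1
    field_simp [hw b]
  · intro b y hy
    rw [norm_mul, norm_latTerm_numerator]
    have h1 : ‖(2 * Real.pi * I : ℂ)‖ = 2 * Real.pi := by
      simp [abs_of_pos Real.pi_pos]
    rw [h1]
    refine mul_le_mul_of_nonneg_left (Real.exp_le_exp.mpr ?_) (by positivity)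
    have h2 : |y| ≤ |c| + 1 := by
      have h3 : |y - c| ≤ 1 := abs_le.mpr ⟨by linarith [hy.1], by linarith [hy.2]⟩
      have := abs_sub_abs_le_abs_sub y c
      linarith
    have h4 : -(y * w.im) ≤ (|c| + 1) * |w.im| :=
      (neg_le_abs _).trans (by rw [abs_mul]; exact mul_le_mul_of_nonneg_right h2 (abs_nonneg _))
    nlinarith [Real.pi_pos]
  · constructor <;> linarith
  · constructor <;> linarith

lemma tsum_latTerm_add_one (α s c : ℝ) (w : ℂ) :
    ∑' b, latTerm α s (c + 1) w b = cexp (2 * Real.pi * I * w) * ∑' b, latTerm α s c w b := by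
  rw [← tsum_mul_left]
  refine tsum_congr fun b => ?_
  have hb : cexp (2 * Real.pi * I * w) = cexp (2 * Real.pi * I * (w + b)) := by
    rw [Complex.exp_eq_exp_iff_exists_int]
    exact ⟨-b, by push_cast; ring⟩
  rw [hb]
  unfold latTerm
  rw [← mul_div_assoc, ← Complex.exp_add, ← Complex.exp_add, ← Complex.exp_add]
  congr 2
  push_cast
  ring

lemma tsum_errTerm_add_one {α : ℝ} (hα : 0 < α) (s c : ℝ) (w : ℂ) :
    ∑' p, errTerm α s (c + 1) w p =
      cexp (2 * Real.pi * I * w) * ∑' p, errTerm α s c w p + 2 * cexp (2 * Real.pi * I * s * w) := by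
  have hshift : ∀ p : ℤ, errTerm α s (c + 1) w (Equiv.addRight 1 p) =
      cexp (2 * Real.pi * I * w) * errTerm α s c w p +
        if p = -1 then 2 * cexp (2 * Real.pi * I * s * w) else 0 := by
    intro p
    have harg : (s + ((p + 1 : ℤ) : ℝ) - (c + 1)) = s + p - c := by push_cast; ring
    have hexp : cexp (2 * Real.pi * I * (s + ((p + 1 : ℤ) : ℂ)) * w) =
        cexp (2 * Real.pi * I * w) * cexp (2 * Real.pi * I * (s + p) * w) := by
      rw [← Complex.exp_add]
      congr 1
      push_cast
      ring
    simp only [errTerm, Equiv.coe_addRight]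
    rw [harg, hexp]
    split_ifs with hp
    · subst hp
      have hexp' : cexp (2 * Real.pi * I * s * w) = cexp (2 * Real.pi * I * w) *
          cexp (2 * Real.pi * I * (s + ((-1 : ℤ) : ℂ)) * w) := by
        rw [← Complex.exp_add]
        congr 1
        push_cast
        ring
      rw [hexp']
      simp [intSign]
      ring
    · have : intSign (p + 1) = intSign p := by
        unfold intSign
        have : 0 ≤ p + 1 ↔ 0 ≤ p := by omega
        simp [this]
      rw [this]
      ring
  rw [← (Equiv.addRight (1 : ℤ)).tsum_eq, tsum_congr hshift,
    Summable.tsum_add ((summable_errTerm hα s c w).mul_left _)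
      (summable_of_hasFiniteSupport ((Set.finite_singleton (-1 : ℤ)).subset (by
        intro p hp; by_contra h; simp at h; simp [h] at hp))),
    tsum_mul_left, tsum_ite_eq]

theorem appell_summand_eq_latticeSum {α : ℝ} (hα : 0 < α) (s c : ℝ) {w : ℂ}
    (hw : ∀ b : ℤ, w + b ≠ 0) :
    cexp (2 * Real.pi * I * s * w) / (1 - cexp (2 * Real.pi * I * w)) -
        1 / 2 * ∑' p, errTerm α s c w p =
      -(1 / (2 * Real.pi * I)) * ∑' b, latTerm α s c w b := by
  have hpi : (2 * Real.pi * I : ℂ) ≠ 0 := Complex.two_pi_I_ne_zero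
  have hq : 1 - cexp (2 * Real.pi * I * w) ≠ 0 := by
    intro h
    obtain ⟨n, hn⟩ := Complex.exp_eq_one_iff.mp (sub_eq_zero.mp h).symm
    apply hw (-n)
    have : w = n := mul_left_cancel₀ hpi (by rw [hn]; ring)
    rw [this]
    push_cast
    ring
  set D : ℝ → ℂ := fun c => cexp (2 * Real.pi * I * s * w) / (1 - cexp (2 * Real.pi * I * w)) -
    1 / 2 * ∑' p, errTerm α s c w p + 1 / (2 * Real.pi * I) * ∑' b, latTerm α s c w b with hD
  have hder : ∀ c, HasDerivAt D 0 c := by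
    intro c
    have h := (((hasDerivAt_tsum_errTerm hα s w c).const_mul (1 / 2 : ℂ)).const_sub
      (cexp (2 * Real.pi * I * s * w) / (1 - cexp (2 * Real.pi * I * w)))).add
      ((hasDerivAt_tsum_latTerm hα s hw c).const_mul (1 / (2 * Real.pi * I)))
    convert! h using 1
    rw [tsum_gaussian_poisson hα]
    field_simp
    ring
  have hconst : D (c + 1) = D c :=
    is_const_of_deriv_eq_zero (fun c => (hder c).differentiableAt) (fun c => (hder c).deriv) _ _
  have hstep : D (c + 1) = cexp (2 * Real.pi * I * w) * D c := by
    simp only [hD]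
    rw [tsum_latTerm_add_one, tsum_errTerm_add_one hα]
    field_simp
    ring
  have hzero : D c = 0 := by
    have : (1 - cexp (2 * Real.pi * I * w)) * D c = 0 := by
      linear_combination hstep - hconst
    exact (mul_eq_zero.mp this).resolve_left hq
  simp only [hD] at hzero
  linear_combination hzero

end Appell

section LatticeSum

open Filter Complex

lemma norm_mexp (w : ℂ) : ‖mexp w‖ = Real.exp (-2 * Real.pi * w.im) := by
  have := norm_cexp_two_pi 1 w
  simpa [mexp] using this

lemma sum_range_tsum_residue {M : ℕ} (hM : 0 < M) {f : ℤ → ℂ} (hf : Summable f) :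
    ∑ i ∈ Finset.range M, ∑' k : ℤ, f (k * M + i) = ∑' p, f p := by
  have : NeZero M := ⟨hM.ne'⟩
  let e : Fin M × ℤ ≃ ℤ := (Equiv.prodComm _ _).trans (Int.divModEquiv M).symm
  have he : ∀ q : Fin M × ℤ, e q = q.2 * M + ((q.1 : ℕ) : ℤ) := fun q => rfl
  have hfe : Summable fun q => f (e q) := (e.summable_iff (f := f)).mpr hf
  rw [← e.tsum_eq, hfe.tsum_prod, tsum_fintype,
    Finset.sum_range]
  simp only [he]

lemma norm_zpow_eq_one {ε : ℂ} (h : ‖ε‖ = 1) (n : ℤ) : ‖ε ^ n‖ = 1 := by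
  rw [norm_zpow, h, one_zpow]

lemma sign_eq_intSign {m : ℝ} (hm : 1 ≤ 2 * m) (j : ℝ) (k : ℤ) :
    Real.sign (j + 2 * m * k - 1 / 2 - j + 2 * m) = intSign k := by
  have h : j + 2 * m * k - 1 / 2 - j + 2 * m = 2 * m * ((k : ℝ) + 1) - 1 / 2 := by ring
  rw [h, intSign]
  split_ifs with hk
  · have hk' : (0 : ℝ) ≤ k := by exact_mod_cast hk
    exact Real.sign_of_pos (by nlinarith)
  · have hk' : (k : ℝ) + 1 ≤ 0 := by exact_mod_cast (by omega : k + 1 ≤ 0)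
    exact Real.sign_of_neg (by nlinarith)

lemma summable_norm_RS_term {ε : ℂ} (hε : ‖ε‖ = 1) {m : ℝ} (hm : 1 ≤ 2 * m) (j : ℝ) {τ : ℂ}
    (hτ : 0 < τ.im) (z : ℂ) :
    Summable fun k : ℤ => ‖ε ^ k *
      (((Real.sign (j + 2 * m * k - 1 / 2 - j + 2 * m) -
        Efun (psiMN m (j + 2 * m * k) τ z) : ℝ)) : ℂ) *
      cexp (-(Real.pi : ℂ) * I * (((j + 2 * m * k : ℝ)) : ℂ) ^ 2 * τ / (2 * (m : ℂ))
        + 2 * (Real.pi : ℂ) * I * (((j + 2 * m * k : ℝ)) : ℂ) * z)‖ := by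
  have hm0 : 0 < m := by linarith
  have hα : 0 < τ.im / m := div_pos hτ hm0
  have hs := Real.sqrt_pos.mpr hα
  set α := τ.im / m with hα'
  set c := 2 * m * z.im / τ.im with hc
  refine Summable.of_norm_bounded_eventually (summable_exp_neg_quadratic
    (a := 2 * Real.pi * α * m ^ 2) (by positivity)
    (-2 * Real.pi * α * m * j + 4 * Real.pi * α * c * m - 4 * Real.pi * m * z.im)
    (-Real.pi * α * j ^ 2 / 2 + 2 * Real.pi * α * c * j - Real.pi * α * c ^ 2
      - 2 * Real.pi * j * z.im)) ?_
  filter_upwards [eventually_abs_intSign_sub_Efun_le (A := 2 * m * Real.sqrt α) (by positivity)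
    ((j - c) * Real.sqrt α)] with k hk
  have h1 : 2 * m * Real.sqrt α * k + (j - c) * Real.sqrt α = psiMN m (j + 2 * m * k) τ z := by
    rw [psiMN, ← hα', ← hc]
    ring
  have h2 : ‖cexp (-(Real.pi : ℂ) * I * (((j + 2 * m * k : ℝ)) : ℂ) ^ 2 * τ / (2 * (m : ℂ))
        + 2 * (Real.pi : ℂ) * I * (((j + 2 * m * k : ℝ)) : ℂ) * z)‖ =
      Real.exp (Real.pi * α / 2 * (j + 2 * m * k) ^ 2 - 2 * Real.pi * (j + 2 * m * k) * z.im) := by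
    rw [Complex.norm_exp]
    congr 1
    have h3 : -(Real.pi : ℂ) * I * (((j + 2 * m * k : ℝ)) : ℂ) ^ 2 * τ / (2 * (m : ℂ))
        + 2 * (Real.pi : ℂ) * I * (((j + 2 * m * k : ℝ)) : ℂ) * z =
        ((-Real.pi * (j + 2 * m * k) ^ 2 / (2 * m) : ℝ) : ℂ) * (I * τ) +
          ((2 * Real.pi * (j + 2 * m * k) : ℝ) : ℂ) * (I * z) := by
      push_cast
      ring
    rw [h3, Complex.add_re, Complex.re_ofReal_mul, Complex.re_ofReal_mul, Complex.I_mul_re,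
      Complex.I_mul_re, hα']
    field_simp
    ring
  rw [norm_norm, norm_mul, norm_mul, norm_zpow_eq_one hε, one_mul, h2, Complex.norm_real,
    Real.norm_eq_abs, sign_eq_intSign hm]
  rw [h1] at hk
  refine (mul_le_mul_of_nonneg_right hk (Real.exp_pos _).le).trans_eq ?_
  rw [← Real.exp_add, ← h1]
  rw [show (2 * m * Real.sqrt α * k + (j - c) * Real.sqrt α) =
    (j + 2 * m * k - c) * Real.sqrt α by ring, mul_pow, Real.sq_sqrt hα.le]
  congr 1
  ring

lemma summable_norm_ThetaS_term {ε : ℂ} (hε : ‖ε‖ = 1) {m : ℝ} (hm : 0 < m) (j : ℝ) {τ : ℂ}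
    (hτ : 0 < τ.im) (z : ℂ) :
    Summable fun n : ℤ => ‖ε ^ n *
      mexp ((m : ℂ) * z * ((n : ℂ) + ((j / (2 * m) : ℝ) : ℂ)) +
        τ * (m : ℂ) * ((n : ℂ) + ((j / (2 * m) : ℝ) : ℂ)) ^ 2)‖ := by
  set h := j / (2 * m)
  refine (summable_exp_neg_quadratic (a := 2 * Real.pi * m * τ.im) (by positivity)
    (-2 * Real.pi * m * z.im - 4 * Real.pi * m * τ.im * h)
    (-2 * Real.pi * m * z.im * h - 2 * Real.pi * m * τ.im * h ^ 2)).congr fun n => ?_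
  rw [norm_mul, norm_zpow_eq_one hε, one_mul, norm_mexp]
  have h3 : (m : ℂ) * z * ((n : ℂ) + (h : ℂ)) + τ * (m : ℂ) * ((n : ℂ) + (h : ℂ)) ^ 2 =
      ((m * (n + h) : ℝ) : ℂ) * z + ((m * (n + h) ^ 2 : ℝ) : ℂ) * τ := by
    push_cast
    ring
  rw [h3, Complex.add_im, Complex.im_ofReal_mul, Complex.im_ofReal_mul]
  congr 1
  ring

lemma RS_mul_ThetaS_term {ε : ℂ} (hε : ε * ε = 1) {m : ℝ} {M : ℕ} (hM : 0 < M)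
    (hm : m = M / 2) (s : ℝ) (τ z₁ z₂ : ℂ) {i : ℕ} (hi : i < M) (N k : ℤ) :
    (ε ^ k *
      (((Real.sign ((s + i) + 2 * m * k - 1 / 2 - (s + i) + 2 * m) -
        Efun (psiMN m ((s + i) + 2 * m * k) τ ((z₁ - z₂) / 2)) : ℝ)) : ℂ) *
      cexp (-(Real.pi : ℂ) * I * ((((s + i) + 2 * m * k : ℝ)) : ℂ) ^ 2 * τ / (2 * (m : ℂ))
        + 2 * (Real.pi : ℂ) * I * ((((s + i) + 2 * m * k : ℝ)) : ℂ) * ((z₁ - z₂) / 2))) *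
    (ε ^ (N + k) *
      mexp ((m : ℂ) * (z₁ + z₂) * (((N + k : ℤ) : ℂ) + (((s + i) / (2 * m) : ℝ) : ℂ)) +
        τ * (m : ℂ) * (((N + k : ℤ) : ℂ) + (((s + i) / (2 * m) : ℝ) : ℂ)) ^ 2)) =
    (ε ^ N * mexp (m * N * (z₁ + z₂) + τ * (m * N ^ 2))) *
      errTerm (τ.im / m) s (2 * m * ((z₁ - z₂) / 2).im / τ.im) (z₁ + N * τ) (k * M + i) := by
  have hM' : (1 : ℝ) ≤ M := by exact_mod_cast hM
  have h2m : 2 * m = M := by rw [hm]; ring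
  have hm0 : (m : ℂ) ≠ 0 := by
    have : 0 < m := by linarith
    exact_mod_cast this.ne'
  have hε0 : ε ≠ 0 := by rintro rfl; simp at hε
  have hsg : intSign (k * M + i) = intSign k := by
    have : 0 ≤ k * (M : ℤ) + i ↔ 0 ≤ k := by
      constructor
      · intro h
        by_contra hk
        have : k * (M : ℤ) ≤ -1 * M := mul_le_mul_of_nonneg_right (by omega) (by omega)
        omega
      · intro h
        positivity
    simp [intSign, this]
  have hpow : ε ^ k * ε ^ (N + k) = ε ^ N := by
    rw [zpow_add₀ hε0, mul_left_comm, ← mul_zpow, hε, one_zpow, mul_one]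
  have hMC : (M : ℂ) = 2 * m := by exact_mod_cast h2m.symm
  have hexp : cexp (-(Real.pi : ℂ) * I * ((((s + i) + 2 * m * k : ℝ)) : ℂ) ^ 2 * τ / (2 * (m : ℂ))
        + 2 * (Real.pi : ℂ) * I * ((((s + i) + 2 * m * k : ℝ)) : ℂ) * ((z₁ - z₂) / 2)) *
      mexp ((m : ℂ) * (z₁ + z₂) * (((N + k : ℤ) : ℂ) + (((s + i) / (2 * m) : ℝ) : ℂ)) +
        τ * (m : ℂ) * (((N + k : ℤ) : ℂ) + (((s + i) / (2 * m) : ℝ) : ℂ)) ^ 2) =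
      mexp (m * N * (z₁ + z₂) + τ * (m * N ^ 2)) *
        cexp (2 * Real.pi * I * (s + ((k * M + i : ℤ) : ℂ)) * (z₁ + N * τ)) := by
    unfold mexp
    rw [← Complex.exp_add, ← Complex.exp_add]
    congr 1
    push_cast
    rw [hMC]
    field_simp
    ring
  have hpsi : psiMN m ((s + i) + 2 * m * k) τ ((z₁ - z₂) / 2) =
      (s + ((k * M + i : ℤ) : ℝ) - 2 * m * ((z₁ - z₂) / 2).im / τ.im) *
        Real.sqrt (τ.im / m) := by
    rw [psiMN, h2m]
    push_cast
    ring
  rw [errTerm, hsg, ← hpsi, sign_eq_intSign (h2m ▸ hM')]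
  rw [← hpow]
  linear_combination (ε ^ k * ε ^ (N + k) * ((intSign k -
    Efun (psiMN m ((s + i) + 2 * m * k) τ ((z₁ - z₂) / 2)) : ℝ) : ℂ)) * hexp

lemma RS_mul_ThetaS {ε : ℂ} (hε : ε * ε = 1) {m : ℝ} {M : ℕ} (hM : 0 < M)
    (hm : m = M / 2) (s : ℝ) {τ : ℂ} (hτ : 0 < τ.im) (z₁ z₂ : ℂ) {i : ℕ} (hi : i < M) :
    HasSum (fun N : ℤ => (ε ^ N * mexp (m * N * (z₁ + z₂) + τ * (m * N ^ 2))) *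
      ∑' k : ℤ, errTerm (τ.im / m) s (2 * m * ((z₁ - z₂) / 2).im / τ.im) (z₁ + N * τ) (k * M + i))
      (RS ε (s + i) m τ ((z₁ - z₂) / 2) * ThetaS ε (s + i) m τ (z₁ + z₂)) := by
  have hM' : (1 : ℝ) ≤ M := by exact_mod_cast hM
  have h2m : 2 * m = M := by rw [hm]; ring
  have hε1 : ‖ε‖ = 1 := by
    have : ‖ε‖ * ‖ε‖ = 1 := by rw [← norm_mul, hε, norm_one]
    nlinarith [norm_nonneg ε]
  have hR := summable_norm_RS_term hε1 (h2m ▸ hM') (s + i) hτ ((z₁ - z₂) / 2)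
  have hT := summable_norm_ThetaS_term hε1 (by linarith : 0 < m) (s + i) hτ (z₁ + z₂)
  let e : ℤ × ℤ ≃ ℤ × ℤ :=
    (Equiv.prodComm ℤ ℤ).trans (Equiv.prodShear (Equiv.refl ℤ) fun k => Equiv.addRight k)
  have hsum := (e.summable_iff).mpr (summable_mul_of_summable_norm hR hT)
  have hval := tsum_mul_tsum_of_summable_norm hR hT
  rw [← e.tsum_eq] at hval
  have hterm : ∀ q : ℤ × ℤ, _ = _ := fun q =>
    RS_mul_ThetaS_term hε hM hm s τ z₁ z₂ hi q.1 q.2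
  have hsum' := hsum.congr hterm
  unfold RS ThetaS
  rw [hval.trans (tsum_congr hterm), hsum'.tsum_prod]
  simp only [← tsum_mul_left]
  exact hsum'.prod.hasSum

lemma hasSum_PhiAddS {ε : ℂ} (hε : ε * ε = 1) {m : ℝ} {M : ℕ} (hM : 0 < M)
    (hm : m = M / 2) (s : ℝ) {τ : ℂ} (hτ : 0 < τ.im) (z₁ z₂ : ℂ) :
    HasSum (fun N : ℤ => (ε ^ N * mexp (m * N * (z₁ + z₂) + τ * (m * N ^ 2))) *
      ∑' p : ℤ, errTerm (τ.im / m) s (2 * m * ((z₁ - z₂) / 2).im / τ.im) (z₁ + N * τ) p)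
      (PhiAddS ε m s τ z₁ z₂) := by
  have hm0 : 0 < m := by rw [hm]; positivity
  have hceil : ⌈2 * m⌉₊ = M := by
    rw [show 2 * m = M by rw [hm]; ring, Nat.ceil_natCast]
  rw [PhiAddS, hceil]
  refine (hasSum_sum fun i hi =>
    RS_mul_ThetaS hε hM hm s hτ z₁ z₂ (Finset.mem_range.mp hi)).congr_fun ?_
  intro N
  rw [← Finset.mul_sum, sum_range_tsum_residue hM (summable_errTerm (div_pos hτ hm0) s _ _)]

end LatticeSum

section Modular

open Filter Complex

/-- The exponent of the Gaussian in the lattice sum representing `PhiTilde`; here `y` stands for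
the imaginary part of `τ` and `d` for that of `z₁ - z₂`. -/
noncomputable def latticeExponent (m y d τ z₁ z₂ N b : ℂ) : ℂ :=
  2 * Real.pi * I * (m * N * (z₁ + z₂) + τ * (m * N ^ 2)) +
    (-Real.pi * (z₁ + N * τ + b) ^ 2 / (y / m) + 2 * Real.pi * I * (m * d / y) * (z₁ + N * τ + b))

/-- The general term, indexed by `(N, b)`, of the lattice sum over `z₁ + N τ + b`. -/
noncomputable def latticeTerm (ε η : ℂ) (m : ℝ) (τ z₁ z₂ : ℂ) (q : ℤ × ℤ) : ℂ :=
  ε ^ q.1 * η ^ q.2 * cexp (latticeExponent m τ.im (z₁ - z₂).im τ z₁ z₂ q.1 q.2) *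
    (z₁ + q.1 * τ + q.2)⁻¹

lemma mul_latTerm_eq_latticeTerm (ε : ℂ) (m s : ℝ) (τ z₁ z₂ : ℂ) (N b : ℤ) :
    (ε ^ N * mexp (m * N * (z₁ + z₂) + τ * (m * N ^ 2))) *
      latTerm (τ.im / m) s (2 * m * ((z₁ - z₂) / 2).im / τ.im) (z₁ + N * τ) b =
    latticeTerm ε (mexp (-s)) m τ z₁ z₂ (N, b) := by
  have h1 : mexp (-s) ^ b = cexp (-2 * Real.pi * I * s * b) := by
    rw [mexp, ← Complex.exp_int_mul]
    congr 1
    ring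
  have h2 : ((2 * m * ((z₁ - z₂) / 2).im / τ.im : ℝ) : ℂ) = m * ((z₁ - z₂).im : ℂ) / τ.im := by
    have : ((z₁ - z₂) / 2).im = (z₁ - z₂).im / 2 := by simp
    rw [this]
    push_cast
    ring
  have h3 : cexp (latticeExponent m τ.im (z₁ - z₂).im τ z₁ z₂ N b) =
      mexp (m * N * (z₁ + z₂) + τ * (m * N ^ 2)) *
        cexp (-Real.pi * (z₁ + N * τ + b) ^ 2 / (τ.im / m : ℝ) +
          2 * Real.pi * I * (m * ((z₁ - z₂).im : ℂ) / τ.im) * (z₁ + N * τ + b)) := by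
    rw [latticeExponent, Complex.exp_add, mexp, Complex.ofReal_div]
  rw [latTerm, latticeTerm, h1, h2, h3]
  ring

lemma tendsto_inv_lattice {τ : ℂ} (hτ : 0 < τ.im) (z : ℂ) :
    Tendsto (fun q : ℤ × ℤ => (z + q.1 * τ + q.2)⁻¹) cofinite (nhds 0) := by
  refine tendsto_inv₀_cobounded.comp ?_
  refine tendsto_norm_atTop_iff_cobounded.mp ?_
  set K : ℝ := 1 / τ.im + 1 + ‖τ‖ / τ.im with hK
  have hK0 : 0 < K := by positivity
  have hnorm : Tendsto (fun q : ℤ × ℤ => ‖q‖) cofinite atTop := by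
    rw [← cocompact_eq_cofinite]
    exact tendsto_norm_cocompact_atTop
  refine tendsto_atTop_mono (fun q => ?_) (tendsto_atTop_add_const_right _ (-‖z‖)
    (hnorm.atTop_div_const hK0))
  have h1 : |(q.1 : ℝ)| * τ.im ≤ ‖(q.1 * τ + q.2 : ℂ)‖ := by
    have := Complex.abs_im_le_norm (q.1 * τ + q.2 : ℂ)
    simpa [abs_mul, abs_of_pos hτ] using this
  have h2 : |(q.2 : ℝ)| ≤ ‖(q.1 * τ + q.2 : ℂ)‖ + |(q.1 : ℝ)| * ‖τ‖ := by
    have := norm_sub_le (q.1 * τ + q.2 : ℂ) (q.1 * τ)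
    rw [add_sub_cancel_left, norm_mul] at this
    simpa using this
  have h3 : ‖(q.1 * τ + q.2 : ℂ)‖ ≤ ‖z + q.1 * τ + q.2‖ + ‖z‖ := by
    have := norm_sub_le (z + q.1 * τ + q.2) z
    rwa [show z + q.1 * τ + q.2 - z = q.1 * τ + q.2 by ring] at this
  set L := ‖(q.1 * τ + q.2 : ℂ)‖
  have hL : 0 ≤ L := norm_nonneg _
  have h4 : |(q.1 : ℝ)| ≤ L / τ.im := (le_div_iff₀ hτ).mpr h1
  have h5 : |(q.1 : ℝ)| * ‖τ‖ ≤ L / τ.im * ‖τ‖ := mul_le_mul_of_nonneg_right h4 (norm_nonneg _)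
  have h6 : ‖q‖ ≤ L * K := by
    have hLK : L * K = L / τ.im + L + L / τ.im * ‖τ‖ := by rw [hK]; ring
    have h7 : 0 ≤ L / τ.im := by positivity
    have h8 : 0 ≤ L / τ.im * ‖τ‖ := by positivity
    rw [Prod.norm_def, hLK]
    refine max_le ?_ ?_
    · rw [Int.norm_eq_abs]; linarith
    · rw [Int.norm_eq_abs]; linarith
  have h9 : ‖q‖ / K ≤ L := (div_le_iff₀ hK0).mpr h6
  linarith

lemma latticeExponent_re (m : ℝ) (τ z₁ z₂ : ℂ) (d : ℝ) (N b : ℤ) :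
    (latticeExponent m τ.im d τ z₁ z₂ N b).re =
      -2 * Real.pi * (m * N * (z₁ + z₂).im + τ.im * (m * N ^ 2)) +
        (-Real.pi * m / τ.im * ((z₁.re + N * τ.re + b) ^ 2 - (z₁.im + N * τ.im) ^ 2) -
          2 * Real.pi * (m * d / τ.im) * (z₁.im + N * τ.im)) := by
  have h : latticeExponent m τ.im d τ z₁ z₂ N b =
      ((2 * Real.pi * (m * N) : ℝ) : ℂ) * (I * (z₁ + z₂)) +
      ((2 * Real.pi * (m * N ^ 2) : ℝ) : ℂ) * (I * τ) +
      (((-Real.pi * m / τ.im : ℝ) : ℂ) * (z₁ + N * τ + b) ^ 2 +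
      ((2 * Real.pi * (m * d / τ.im) : ℝ) : ℂ) * (I * (z₁ + N * τ + b))) := by
    rw [latticeExponent, div_div_eq_mul_div]
    push_cast
    ring
  rw [h]
  simp only [Complex.add_re, Complex.re_ofReal_mul, Complex.I_mul_re]
  simp only [pow_two, Complex.mul_re, Complex.add_re, Complex.add_im, Complex.mul_im,
    Complex.intCast_re, Complex.intCast_im]
  ring

lemma summable_latticeTerm {ε η : ℂ} (hε : ‖ε‖ = 1) (hη : ‖η‖ = 1) {m : ℝ} (hm : 0 < m)
    {τ : ℂ} (hτ : 0 < τ.im) (z₁ z₂ : ℂ) : Summable (latticeTerm ε η m τ z₁ z₂) := by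
  unfold latticeTerm
  refine Summable.mul_tendsto_const ?_ (tendsto_inv_lattice hτ z₁)
  set x := τ.re
  set y := τ.im
  set d := (z₁ - z₂).im
  set κ : ℝ := y ^ 2 / (1 + x ^ 2 + y ^ 2) with hκ
  have hden : 0 < 1 + x ^ 2 + y ^ 2 := by positivity
  have hκ0 : 0 < κ := by positivity
  have hβ : 0 < Real.pi * m / y := by positivity
  have hκy : κ * (1 + x ^ 2 + y ^ 2) = y ^ 2 := by rw [hκ]; field_simp
  have hκ1 : κ < 1 := by rw [hκ, div_lt_one hden]; nlinarith [sq_nonneg x]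
  have hquad : ∀ N b : ℝ, κ * (N ^ 2 + b ^ 2) ≤ (N * x + b) ^ 2 + N ^ 2 * y ^ 2 := by
    intro N b
    have h1 : (1 - κ) * ((N * x + b) ^ 2 + N ^ 2 * y ^ 2 - κ * (N ^ 2 + b ^ 2)) =
        ((1 - κ) * b + N * x) ^ 2 + κ ^ 2 * N ^ 2 := by
      linear_combination (-N ^ 2) * hκy
    have h2 : 0 ≤ (1 - κ) * ((N * x + b) ^ 2 + N ^ 2 * y ^ 2 - κ * (N ^ 2 + b ^ 2)) := by
      rw [h1]; positivity
    have h3 := nonneg_of_mul_nonneg_right h2 (by linarith)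
    linarith
  have hN := summable_exp_neg_quadratic (mul_pos hβ hκ0)
    (-2 * Real.pi * m * (z₁ + z₂).im - Real.pi * m / y * (2 * z₁.re * x - 2 * z₁.im * y)
      - 2 * Real.pi * (m * d / y) * y)
    (-Real.pi * m / y * (z₁.re ^ 2 - z₁.im ^ 2) - 2 * Real.pi * (m * d / y) * z₁.im)
  have hb := summable_exp_neg_quadratic (mul_pos hβ hκ0) (-Real.pi * m / y * (2 * z₁.re)) 0
  refine Summable.of_norm_bounded (hN.mul_of_nonneg hb (fun _ => (Real.exp_pos _).le)
    (fun _ => (Real.exp_pos _).le)) fun q => ?_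
  rw [norm_norm, norm_mul, norm_mul, norm_zpow_eq_one hε, norm_zpow_eq_one hη, one_mul, one_mul,
    Complex.norm_exp, latticeExponent_re, ← Real.exp_add]
  refine Real.exp_le_exp.mpr ?_
  have h := mul_le_mul_of_nonneg_left (hquad q.1 q.2) hβ.le
  have hy : Real.pi * m / y * (q.1 ^ 2 * y ^ 2) * 2 = 2 * Real.pi * (y * (m * q.1 ^ 2)) := by
    field_simp
  linear_combination h + hy

theorem PhiTilde_eq_latticeSum {ε : ℂ} (hε : ε * ε = 1) {m : ℝ} {M : ℕ} (hM : 0 < M)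
    (hm : m = M / 2) (s : ℝ) {τ : ℂ} (hτ : 0 < τ.im) {z₁ : ℂ} (z₂ : ℂ)
    (hz : ∀ a b : ℤ, z₁ ≠ (a : ℂ) + (b : ℂ) * τ) :
    PhiTilde ε m s τ z₁ z₂ =
      -(1 / (2 * Real.pi * I)) * ∑' q, latticeTerm ε (mexp (-s)) m τ z₁ z₂ q := by
  have hm0 : 0 < m := by rw [hm]; positivity
  have hα : 0 < τ.im / m := div_pos hτ hm0
  have hε1 : ‖ε‖ = 1 := by
    have : ‖ε‖ * ‖ε‖ = 1 := by rw [← norm_mul, hε, norm_one]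
    nlinarith [norm_nonneg ε]
  have hη1 : ‖mexp (-s)‖ = 1 := by rw [norm_mexp]; simp
  have hw : ∀ N b : ℤ, z₁ + N * τ + b ≠ 0 := by
    intro N b h
    apply hz (-b) (-N)
    push_cast
    linear_combination h
  have hF := summable_latticeTerm hε1 hη1 hm0 hτ z₁ z₂
  have hA := hasSum_PhiAddS hε hM hm s hτ z₁ z₂
  have hL := hF.prod.hasSum
  rw [← hF.tsum_prod] at hL
  have hΦ : HasSum (fun N : ℤ => ε ^ N *
      mexp ((m : ℂ) * N * (z₁ + z₂) + (s : ℂ) * z₁ + τ * ((m : ℂ) * N ^ 2 + (s : ℂ) * N)) /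
        (1 - mexp (z₁ + N * τ))) (-(1 / (2 * Real.pi * I)) *
          ∑' q, latticeTerm ε (mexp (-s)) m τ z₁ z₂ q + 1 / 2 * PhiAddS ε m s τ z₁ z₂) := by
    refine ((hL.mul_left (-(1 / (2 * Real.pi * I)))).add (hA.mul_left (1 / 2))).congr_fun ?_
    intro N
    have h := appell_summand_eq_latticeSum hα s (2 * m * ((z₁ - z₂) / 2).im / τ.im) (hw N)
    simp only [← mul_latTerm_eq_latticeTerm]
    rw [tsum_mul_left]
    have he : mexp ((m : ℂ) * N * (z₁ + z₂) + (s : ℂ) * z₁ +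
        τ * ((m : ℂ) * N ^ 2 + (s : ℂ) * N)) =
        mexp (m * N * (z₁ + z₂) + τ * (m * N ^ 2)) *
          cexp (2 * Real.pi * I * s * (z₁ + N * τ)) := by
      unfold mexp
      rw [← Complex.exp_add]
      congr 1
      ring
    rw [he, mexp.eq_def (z₁ + N * τ)]
    linear_combination (ε ^ N * mexp (m * N * (z₁ + z₂) + τ * (m * N ^ 2))) * h
  rw [PhiTilde, PhiS, hΦ.tsum_eq]
  ring

lemma latticeExponent_S (m τ τ' z₁ z₂ d' N b : ℂ) (hτ : τ ≠ 0) (hτ' : τ' ≠ 0)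
    (hττ' : τ - τ' ≠ 0) :
    latticeExponent m ((-1 / τ - -1 / τ') / (2 * I)) (((z₁ - z₂) / τ - d' / τ') / (2 * I))
      (-1 / τ) (z₁ / τ) (z₂ / τ) N b =
    2 * Real.pi * I * (m * z₁ * z₂ / τ) +
      latticeExponent m ((τ - τ') / (2 * I)) ((z₁ - z₂ - d') / (2 * I)) τ z₁ z₂ b (-N) +
      (-(2 * m * N * b)) * (2 * Real.pi * I) := by
  have hI := I_ne_zero
  have h1 : (-1 / τ - -1 / τ') / (2 * I) = (τ - τ') / (2 * I * τ * τ') := by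
    field_simp
    ring
  rw [h1]
  unfold latticeExponent
  rcases eq_or_ne m 0 with rfl | hm
  · simp
  field_simp
  ring_nf

lemma ofReal_im_eq (z : ℂ) : (z.im : ℂ) = (z - (starRingEnd ℂ) z) / (2 * I) := by
  rw [Complex.im_eq_sub_conj]

lemma latticeTerm_S {ε η : ℂ} (hε : ε * ε = 1) {m : ℝ} {M : ℕ}
    (hm : m = M / 2) {τ : ℂ} (hτ : 0 < τ.im) (z₁ z₂ : ℂ) (N b : ℤ) :
    latticeTerm ε η m (-1 / τ) (z₁ / τ) (z₂ / τ) (N, b) =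
      τ * mexp (m * z₁ * z₂ / τ) * latticeTerm η ε m τ z₁ z₂ (b, -N) := by
  have hτ0 : τ ≠ 0 := by rintro rfl; simp at hτ
  have hτ0' : (starRingEnd ℂ) τ ≠ 0 := by simpa using hτ0
  have hsub : τ - (starRingEnd ℂ) τ ≠ 0 := by
    intro h
    have := congrArg Complex.im h
    simp at this
    linarith
  have hexp : cexp (latticeExponent m (-1 / τ).im (z₁ / τ - z₂ / τ).im (-1 / τ) (z₁ / τ) (z₂ / τ)
      N b) = mexp (m * z₁ * z₂ / τ) *
        cexp (latticeExponent m τ.im (z₁ - z₂).im τ z₁ z₂ b (-N)) := by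
    rw [mexp, ← Complex.exp_add, Complex.exp_eq_exp_iff_exists_int]
    refine ⟨-(M * N * b), ?_⟩
    have h := latticeExponent_S m τ ((starRingEnd ℂ) τ) z₁ z₂ ((starRingEnd ℂ) (z₁ - z₂)) N b
      hτ0 hτ0' hsub
    rw [ofReal_im_eq, ofReal_im_eq, ofReal_im_eq, ofReal_im_eq, ← sub_div, map_div₀, map_div₀,
      map_neg, map_one, h]
    have hM : (m : ℂ) = M / 2 := by rw [hm]; push_cast; rfl
    congr 1
    rw [hM]
    push_cast
    ring
  have hpow : ε ^ (-N) = ε ^ N := by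
    have h : ε⁻¹ = ε := inv_eq_of_mul_eq_one_left hε
    rw [zpow_neg, ← inv_zpow, h]
  have hden : z₁ / τ + N * (-1 / τ) + b = (z₁ + b * τ + ((-N : ℤ) : ℂ)) / τ := by
    push_cast
    field_simp
    ring
  simp only [latticeTerm]
  rw [hexp, hden, hpow, inv_div]
  push_cast
  ring

theorem PhiTilde_S {ε ε' : ℂ} (hε : ε * ε = 1) (hε' : ε' * ε' = 1) {m : ℝ} {M : ℕ} (hM : 0 < M)
    (hm : m = M / 2) {s s' : ℝ} (hs : mexp (-s) = ε') (hs' : mexp (-s') = ε) {τ : ℂ}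
    (hτ : 0 < τ.im) {z₁ : ℂ} (z₂ : ℂ) (hz : ∀ a b : ℤ, z₁ ≠ (a : ℂ) + (b : ℂ) * τ) :
    PhiTilde ε m s (-1 / τ) (z₁ / τ) (z₂ / τ) =
      τ * mexp (m * z₁ * z₂ / τ) * PhiTilde ε' m s' τ z₁ z₂ := by
  have hτ0 : τ ≠ 0 := by rintro rfl; simp at hτ
  have hτS : 0 < (-1 / τ).im := by
    rw [neg_div, one_div, Complex.neg_im, Complex.inv_im, neg_div, neg_neg]
    exact div_pos hτ (Complex.normSq_pos.mpr hτ0)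
  have hzS : ∀ a b : ℤ, z₁ / τ ≠ (a : ℂ) + (b : ℂ) * (-1 / τ) := by
    intro a b h
    apply hz (-b) a
    field_simp at h
    rw [h]
    push_cast
    ring
  let e : ℤ × ℤ ≃ ℤ × ℤ := (Equiv.prodComm ℤ ℤ).trans
    (Equiv.prodCongr (Equiv.refl ℤ) (Equiv.neg ℤ))
  have hterm : ∀ q : ℤ × ℤ, latticeTerm ε ε' m (-1 / τ) (z₁ / τ) (z₂ / τ) q =
      τ * mexp (m * z₁ * z₂ / τ) * latticeTerm ε' ε m τ z₁ z₂ (e q) :=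
    fun q => latticeTerm_S hε hm hτ z₁ z₂ q.1 q.2
  rw [PhiTilde_eq_latticeSum hε hM hm s hτS (z₂ / τ) hzS,
    PhiTilde_eq_latticeSum hε' hM hm s' hτ z₂ hz, hs, hs',
    tsum_congr hterm, tsum_mul_left, e.tsum_eq (latticeTerm ε' ε m τ z₁ z₂)]
  ring

lemma mexp_neg_intCast (n : ℤ) : mexp (-((n : ℝ) : ℂ)) = 1 := by
  rw [mexp, Complex.exp_eq_one_iff]
  exact ⟨-n, by push_cast; ring⟩

lemma mexp_neg_intCast_add_half (n : ℤ) : mexp (-(((n : ℝ) + 1 / 2 : ℝ) : ℂ)) = -1 := by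
  rw [mexp, ← Complex.exp_pi_mul_I, Complex.exp_eq_exp_iff_exists_int]
  exact ⟨-n - 1, by push_cast; ring⟩

end Modular

/-- the four S-transformation formulas for the modified signed mock theta
functions; `m = m2/2 ∈ (1/2)ℤ_{>0}`, `s, s₁ ∈ ℤ`, and the half-integers `s' + 1/2`,
`s₁' + 1/2` with `s', s₁' ∈ ℤ` represent the elements of `1/2 + ℤ`. -/
theorem stmt4 (m2 : ℤ) (hm2 : 0 < m2) (s s₁ s' s₁' : ℤ)
    (τ z₁ z₂ : ℂ) (hτ : 0 < τ.im) (hz : ∀ a b : ℤ, z₁ ≠ (a : ℂ) + (b : ℂ) * τ) :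
    (PhiTilde 1 ((m2 : ℝ) / 2) (s : ℝ) (-1 / τ) (z₁ / τ) (z₂ / τ) =
      τ * mexp ((m2 : ℂ) / 2 * z₁ * z₂ / τ) * PhiTilde 1 ((m2 : ℝ) / 2) (s₁ : ℝ) τ z₁ z₂) ∧
    (PhiTilde (-1) ((m2 : ℝ) / 2) (s : ℝ) (-1 / τ) (z₁ / τ) (z₂ / τ) =
      τ * mexp ((m2 : ℂ) / 2 * z₁ * z₂ / τ) *
        PhiTilde 1 ((m2 : ℝ) / 2) ((s' : ℝ) + 1 / 2) τ z₁ z₂) ∧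
    (PhiTilde 1 ((m2 : ℝ) / 2) ((s' : ℝ) + 1 / 2) (-1 / τ) (z₁ / τ) (z₂ / τ) =
      τ * mexp ((m2 : ℂ) / 2 * z₁ * z₂ / τ) * PhiTilde (-1) ((m2 : ℝ) / 2) (s : ℝ) τ z₁ z₂) ∧
    (PhiTilde (-1) ((m2 : ℝ) / 2) ((s' : ℝ) + 1 / 2) (-1 / τ) (z₁ / τ) (z₂ / τ) =
      τ * mexp ((m2 : ℂ) / 2 * z₁ * z₂ / τ) *
        PhiTilde (-1) ((m2 : ℝ) / 2) ((s₁' : ℝ) + 1 / 2) τ z₁ z₂) := by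
  have hM : 0 < m2.toNat := by omega
  have hcast : ((m2.toNat : ℕ) : ℤ) = m2 := Int.toNat_of_nonneg hm2.le
  have hm : (m2 : ℝ) / 2 = (m2.toNat : ℝ) / 2 := by
    rw [← Int.cast_natCast (R := ℝ) m2.toNat, hcast]
  have hmC : (m2 : ℂ) / 2 = (((m2 : ℝ) / 2 : ℝ) : ℂ) := by push_cast; rfl
  have h1 : (1 : ℂ) * 1 = 1 := by norm_num
  have h2 : (-1 : ℂ) * -1 = 1 := by norm_num
  rw [hmC]
  exact ⟨PhiTilde_S h1 h1 hM hm (mexp_neg_intCast s) (mexp_neg_intCast s₁) hτ z₂ hz,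
    PhiTilde_S h2 h1 hM hm (mexp_neg_intCast s) (mexp_neg_intCast_add_half s') hτ z₂ hz,
    PhiTilde_S h1 h2 hM hm (mexp_neg_intCast_add_half s') (mexp_neg_intCast s) hτ z₂ hz,
    PhiTilde_S h2 h2 hM hm (mexp_neg_intCast_add_half s') (mexp_neg_intCast_add_half s₁') hτ z₂ hz⟩
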